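/- Let d, m ≥ 1, and let Σ be a collection of subsets of ℝ^d with ⋃Σ = ℝ^d. For v ∈ (ℝ^d)^{m+1} define Σ_v := {(τ_1, …, τ_{m+1}) ∈ Σ^{m+1} : ∃ x ∈ ℝ^d such that v_k + x ∈ τ_k for all k}, and similarly for m-tuples. Fix i ∈ {1, …, m+1} and let p_i : (ℝ^d)^{m+1} → (ℝ^d)^m be the projection forgetting the i-th component. If v, w ∈ (ℝ^d)^{m+1} satisfy Σ_v = Σ_w, then Σ_{p_i(v)} = Σ_{p_i(w)}. -/

import Mathlib

/-- For a collection `Sig` of subsets of `ℝ^d` and `v = (v_1,…,v_k) ∈ (ℝ^d)^k`,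
the set `Σ_v` of tuples `(τ_1,…,τ_k) ∈ Sig^k` such that `v_j + x ∈ τ_j` for all `j`,
for some `x ∈ ℝ^d`. -/
def sigmaTuples (d k : ℕ) (Sig : Set (Set (Fin d → ℝ))) (v : Fin k → Fin d → ℝ) :
    Set (Fin k → Set (Fin d → ℝ)) :=
  {τ | (∀ j, τ j ∈ Sig) ∧ ∃ x : Fin d → ℝ, ∀ j, v j + x ∈ τ j}

/-- Forgetting the `i`-th component of the tuples in `Σ_v` yields `Σ_{p_i(v)}`,
as soon as `Sig` covers the space. -/
theorem sigmaTuples_comp_succAbove (d m : ℕ) (Sig : Set (Set (Fin d → ℝ)))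
    (hcover : ⋃₀ Sig = Set.univ) (i : Fin (m + 1)) (v : Fin (m + 1) → Fin d → ℝ) :
    sigmaTuples d m Sig (v ∘ i.succAbove) =
      (fun τ => τ ∘ i.succAbove) '' sigmaTuples d (m + 1) Sig v := by
  ext τ
  constructor
  · rintro ⟨hτ, x, hx⟩
    obtain ⟨σ, hσ, hxσ⟩ : v i + x ∈ ⋃₀ Sig := hcover ▸ Set.mem_univ _
    refine ⟨i.insertNth σ τ, ⟨?_, x, ?_⟩, ?_⟩
    · rw [Fin.forall_iff_succAbove i]
      simpa using ⟨hσ, hτ⟩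
    · rw [Fin.forall_iff_succAbove i]
      simpa using ⟨hxσ, hx⟩
    · funext j
      simp
  · rintro ⟨τ, ⟨hτ, x, hx⟩, rfl⟩
    exact ⟨fun j => hτ _, x, fun j => hx _⟩

/-- If `Sig` covers `ℝ^d` and `Σ_v = Σ_w` for `v, w ∈ (ℝ^d)^{m+1}`, then forgetting the
`i`-th component (via `Fin.succAbove`) yields `Σ_{p_i(v)} = Σ_{p_i(w)}`. -/
theorem stmt_6 (d m : ℕ) (hd : 1 ≤ d) (hm : 1 ≤ m)
    (Sig : Set (Set (Fin d → ℝ)))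
    (hcover : ⋃₀ Sig = Set.univ)
    (i : Fin (m + 1))
    (v w : Fin (m + 1) → Fin d → ℝ)
    (hvw : sigmaTuples d (m + 1) Sig v = sigmaTuples d (m + 1) Sig w) :
    sigmaTuples d m Sig (v ∘ i.succAbove) = sigmaTuples d m Sig (w ∘ i.succAbove) := by
  rw [sigmaTuples_comp_succAbove d m Sig hcover, hvw,
    sigmaTuples_comp_succAbove d m Sig hcover]
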